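/- Let X=X(G) be the flag complex of a finite simple graph G and let k ≥ 1. For every k-cochain φ ∈ C^k(X), k·(Δ_k φ, φ) = Σ_{u∈V} (Δ_{k−1} φ_u, φ_u) − Σ_{σ∈X(k)} ( Σ_{τ∈σ(k−1)} deg(τ) − k·deg(σ) ) φ(σ)². -/

import Mathlib

open Finset
open scoped ENNReal
/-- An ordered tuple of vertices spans a simplex of the flag complex `X(G)`
iff its entries are pairwise adjacent. -/
def SimpleGraph.IsFlagSimplex {V : Type*} (G : SimpleGraph V) {m : ℕ} (σ : Fin m → V) : Prop :=
  ∀ i j : Fin m, i ≠ j → G.Adj (σ i) (σ j)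

/-- A (real) simplicial cochain of `X(G)` in degree `m - 1`: a skew-symmetric function
on ordered `m`-tuples of vertices, supported on the ordered simplices of `X(G)`.
(For `m = 0` this is the augmented degree `-1` part, a copy of `ℝ`.) -/
def SimpleGraph.IsFlagCochain {V : Type*} (G : SimpleGraph V) {m : ℕ}
    (φ : (Fin m → V) → ℝ) : Prop :=
  (∀ σ : Fin m → V, ¬ G.IsFlagSimplex σ → φ σ = 0) ∧
  (∀ (σ : Fin m → V) (π : Equiv.Perm (Fin m)),
    φ (σ ∘ π) = ((Equiv.Perm.sign π : ℤ) : ℝ) * φ σ)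

open scoped Classical in
/-- The simplicial coboundary operator `d` of the flag complex `X(G)`:
`(dφ)(σ) = ∑ i, (-1)^i φ(σ with i-th entry removed)` for an ordered simplex `σ`. -/
noncomputable def SimpleGraph.coboundary {V : Type*} (G : SimpleGraph V) {m : ℕ}
    (φ : (Fin m → V) → ℝ) : (Fin (m + 1) → V) → ℝ :=
  fun σ =>
    if G.IsFlagSimplex σ then
      ∑ i : Fin (m + 1), (-1 : ℝ) ^ (i : ℕ) * φ (σ ∘ i.succAbove)
    else 0
/-- The adjoint `d*` of the coboundary operator (with respect to the standard inner
products on cochains): `(d*φ)(τ) = ∑_{v ∈ lk(τ)} φ(vτ)`. -/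
noncomputable def SimpleGraph.coboundaryAdj {V : Type*} [Fintype V] (G : SimpleGraph V) {m : ℕ}
    (φ : (Fin (m + 1) → V) → ℝ) : (Fin m → V) → ℝ :=
  fun τ => ∑ v : V, φ (Fin.cons v τ)
/-- The reduced `k`-dimensional Laplacian `Δ_k = d_{k-1} d_{k-1}* + d_k* d_k`
of the flag complex `X(G)`, acting on `k`-cochains. -/
noncomputable def SimpleGraph.flagLaplacian {V : Type*} [Fintype V] (G : SimpleGraph V) {k : ℕ}
    (φ : (Fin (k + 1) → V) → ℝ) : (Fin (k + 1) → V) → ℝ :=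
  fun σ => G.coboundary (G.coboundaryAdj φ) σ + G.coboundaryAdj (G.coboundary φ) σ
/-- The standard inner product of two cochains (see `cochainNormSq` for the
normalisation by the number of orderings of each simplex). -/
noncomputable def cochainInner {V : Type*} [Fintype V] [DecidableEq V] {m : ℕ}
    (φ ψ : (Fin m → V) → ℝ) : ℝ :=
  ((Nat.factorial m : ℝ))⁻¹ * ∑ σ : Fin m → V, φ σ * ψ σ
open scoped Classical in
/-- The degree of a simplex `σ` of `X(G)`: the number of simplices of one higher dimension
containing it, i.e. the number of common neighbours of its vertices. -/
noncomputable def SimpleGraph.simplexDeg {V : Type*} [Fintype V] (G : SimpleGraph V) {m : ℕ}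
    (σ : Fin m → V) : ℕ :=
  (Finset.univ.filter fun u : V => G.IsFlagSimplex (Fin.cons u σ)).card
open scoped Classical in
/-- `φ_u`: the cochain `τ ↦ φ(uτ)` if `u ∈ lk(τ)`, and `0` otherwise. -/
noncomputable def SimpleGraph.cochainRes {V : Type*} (G : SimpleGraph V) {m : ℕ}
    (φ : (Fin (m + 1) → V) → ℝ) (u : V) : (Fin m → V) → ℝ :=
  fun τ => if G.IsFlagSimplex (Fin.cons u τ) then φ (Fin.cons u τ) else 0

section TupleSums

variable {V : Type*} [Fintype V]

theorem sum_cons_tuple {m : ℕ} (F : (Fin (m + 1) → V) → ℝ) :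
    ∑ σ, F σ = ∑ v : V, ∑ τ : Fin m → V, F (Fin.cons v τ) := by
  rw [← Fintype.sum_prod_type' (f := fun v τ => F (Fin.cons v τ))]
  exact (Equiv.sum_comp (Fin.consEquiv fun _ : Fin (m + 1) => V) F).symm

theorem sum_apply_removeNth {m : ℕ} (i : Fin (m + 1)) (F : V → (Fin m → V) → ℝ) :
    ∑ σ : Fin (m + 1) → V, F (σ i) (σ ∘ i.succAbove) = ∑ v : V, ∑ τ : Fin m → V, F v τ := by
  rw [← Fintype.sum_prod_type' (f := F)]
  exact Equiv.sum_comp (Fin.insertNthEquiv (fun _ : Fin (m + 1) => V) i).symm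
    (fun p => F p.1 p.2)

end TupleSums

namespace SimpleGraph

variable {V : Type*} {G : SimpleGraph V}

theorem isFlagSimplex_cons {m : ℕ} {v : V} {τ : Fin m → V} :
    G.IsFlagSimplex (Fin.cons v τ : Fin (m + 1) → V) ↔
      (∀ j, G.Adj v (τ j)) ∧ G.IsFlagSimplex τ := by
  constructor
  · intro h
    refine ⟨fun j => ?_, fun i j hij => ?_⟩
    · simpa using h 0 j.succ (Fin.succ_ne_zero j).symm
    · simpa using h i.succ j.succ (by simpa using hij)
  · rintro ⟨h₁, h₂⟩ i j hij
    cases i using Fin.cases with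
    | zero =>
      cases j using Fin.cases with
      | zero => exact absurd rfl hij
      | succ j => simpa using h₁ j
    | succ i =>
      cases j using Fin.cases with
      | zero => simpa using (h₁ i).symm
      | succ j => simpa using h₂ i j (by simpa using hij)

namespace IsFlagCochain

theorem apply_eq_cons_removeNth {m : ℕ} {φ : (Fin (m + 1) → V) → ℝ} (hφ : G.IsFlagCochain φ)
    (i : Fin (m + 1)) (σ : Fin (m + 1) → V) :
    φ σ = (-1) ^ (i : ℕ) * φ (Fin.cons (σ i) (σ ∘ i.succAbove)) := by
  have h : (Fin.cons (σ i) (σ ∘ i.succAbove) : Fin (m + 1) → V) = σ ∘ i.cycleRange.symm := by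
    funext j
    cases j using Fin.cases <;> simp
  rw [h, hφ.2 σ i.cycleRange.symm, Equiv.Perm.sign_symm, Fin.sign_cycleRange]
  push_cast
  rw [← mul_assoc, ← mul_pow]
  norm_num

theorem cons_cons {m : ℕ} {φ : (Fin (m + 2) → V) → ℝ} (hφ : G.IsFlagCochain φ) (u v : V)
    (ρ : Fin m → V) :
    φ (Fin.cons u (Fin.cons v ρ : Fin (m + 1) → V)) =
      -φ (Fin.cons v (Fin.cons u ρ : Fin (m + 1) → V)) := by
  have h := hφ.apply_eq_cons_removeNth 1 (Fin.cons u (Fin.cons v ρ : Fin (m + 1) → V))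
  have h₁ : (Fin.cons u (Fin.cons v ρ : Fin (m + 1) → V) : Fin (m + 2) → V) ∘
      (1 : Fin (m + 2)).succAbove = Fin.cons u ρ := by
    funext j
    cases j using Fin.cases with
    | zero => simp
    | succ j =>
      have : (1 : Fin (m + 2)).succAbove j.succ = j.succ.succ := Fin.one_succAbove_succ j
      simp [this]
  rw [h₁] at h
  have h₂ : (Fin.cons u (Fin.cons v ρ : Fin (m + 1) → V) : Fin (m + 2) → V) 1 = v := rfl
  rw [h₂] at h
  simpa using h

theorem cochainRes_apply {m : ℕ} {φ : (Fin (m + 1) → V) → ℝ} (hφ : G.IsFlagCochain φ) (u : V)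
    (τ : Fin m → V) : G.cochainRes φ u τ = φ (Fin.cons u τ) := by
  unfold SimpleGraph.cochainRes
  split_ifs with h
  · rfl
  · exact (hφ.1 _ h).symm

theorem cochainRes {m : ℕ} {φ : (Fin (m + 1) → V) → ℝ} (hφ : G.IsFlagCochain φ) (u : V) :
    G.IsFlagCochain (G.cochainRes φ u) := by
  refine ⟨fun τ hτ => ?_, fun τ π => ?_⟩
  · rw [hφ.cochainRes_apply]
    exact hφ.1 _ fun h => hτ (isFlagSimplex_cons.1 h).2
  · rw [hφ.cochainRes_apply, hφ.cochainRes_apply]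
    have h : (Fin.cons u (τ ∘ π) : Fin (m + 1) → V) =
        (Fin.cons u τ : Fin (m + 1) → V) ∘ Equiv.Perm.decomposeFin.symm (0, π) := by
      funext j
      cases j using Fin.cases <;> simp
    rw [h, hφ.2]
    simp

variable [Fintype V]

theorem sum_coboundary_coboundaryAdj {m : ℕ} {φ : (Fin (m + 1) → V) → ℝ}
    (hφ : G.IsFlagCochain φ) :
    ∑ σ, G.coboundary (G.coboundaryAdj φ) σ * φ σ =
      ((m : ℝ) + 1) * ∑ τ : Fin m → V, (∑ v : V, φ (Fin.cons v τ)) ^ 2 := by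
  have h₁ (σ : Fin (m + 1) → V) : G.coboundary (G.coboundaryAdj φ) σ * φ σ =
      ∑ i : Fin (m + 1), (∑ v : V, φ (Fin.cons v (σ ∘ i.succAbove))) *
        φ (Fin.cons (σ i) (σ ∘ i.succAbove)) := by
    by_cases hσ : G.IsFlagSimplex σ
    · simp only [coboundary, if_pos hσ, coboundaryAdj, Finset.sum_mul]
      refine Finset.sum_congr rfl fun i _ => ?_
      rw [hφ.apply_eq_cons_removeNth i σ]
      have : ((-1 : ℝ) ^ (i : ℕ)) * (-1) ^ (i : ℕ) = 1 := by rw [← mul_pow]; norm_num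
      rw [← Finset.sum_mul]
      linear_combination (∑ v : V, φ (Fin.cons v (σ ∘ i.succAbove))) *
        φ (Fin.cons (σ i) (σ ∘ i.succAbove)) * this
    · have h₀ := hφ.1 σ hσ
      rw [h₀, mul_zero]
      refine (Finset.sum_eq_zero fun i _ => ?_).symm
      have := hφ.apply_eq_cons_removeNth i σ
      rw [h₀] at this
      rw [(mul_eq_zero.1 this.symm).resolve_left (by simp), mul_zero]
  simp only [h₁]
  rw [Finset.sum_comm]
  simp only [sum_apply_removeNth _ (fun v τ => (∑ w : V, φ (Fin.cons w τ)) * φ (Fin.cons v τ))]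
  simp only [Finset.sum_const, Finset.card_univ, Fintype.card_fin, nsmul_eq_mul]
  push_cast
  congr 1
  rw [Finset.sum_comm]
  refine Finset.sum_congr rfl fun τ _ => ?_
  rw [← Finset.mul_sum, sq]

open scoped Classical in
theorem sum_coboundaryAdj_coboundary {m : ℕ} {φ : (Fin (m + 1) → V) → ℝ}
    (hφ : G.IsFlagCochain φ) :
    ∑ σ, G.coboundaryAdj (G.coboundary φ) σ * φ σ =
      ∑ σ, (G.simplexDeg σ : ℝ) * φ σ ^ 2 -
        ((m : ℝ) + 1) * ∑ τ : Fin m → V, ∑ u : V, ∑ v : V,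
          if G.IsFlagSimplex (Fin.cons v (Fin.cons u τ : Fin (m + 1) → V)) then
            φ (Fin.cons v τ) * φ (Fin.cons u τ) else 0 := by
  have hflag (σ : Fin (m + 1) → V) (i : Fin (m + 1)) (v : V) :
      G.IsFlagSimplex (Fin.cons v (Fin.cons (σ i) (σ ∘ i.succAbove) : Fin (m + 1) → V)) ↔
        G.IsFlagSimplex (Fin.cons v σ : Fin (m + 2) → V) := by
    have h : (Fin.cons v (Fin.cons (σ i) (σ ∘ i.succAbove) : Fin (m + 1) → V) :
        Fin (m + 2) → V) =
        (Fin.cons v σ : Fin (m + 2) → V) ∘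
          Equiv.Perm.decomposeFin.symm (0, i.cycleRange.symm) := by
      funext j
      cases j using Fin.cases with
      | zero => simp
      | succ j => cases j using Fin.cases <;> simp
    rw [h]
    exact ⟨fun H a b hab => by
      simpa using H ((Equiv.Perm.decomposeFin.symm (0, i.cycleRange.symm)).symm a)
        ((Equiv.Perm.decomposeFin.symm (0, i.cycleRange.symm)).symm b) (by simpa using hab),
      fun H a b hab => H _ _ (by simpa using hab)⟩
  have h₁ (σ : Fin (m + 1) → V) : G.coboundaryAdj (G.coboundary φ) σ * φ σ =
      (G.simplexDeg σ : ℝ) * φ σ ^ 2 - ∑ i : Fin (m + 1), ∑ v : V,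
        if G.IsFlagSimplex
            (Fin.cons v (Fin.cons (σ i) (σ ∘ i.succAbove) : Fin (m + 1) → V)) then
          φ (Fin.cons v (σ ∘ i.succAbove)) * φ (Fin.cons (σ i) (σ ∘ i.succAbove)) else 0 := by
    simp only [hflag]
    rw [Finset.sum_comm, simplexDeg, Finset.card_filter]
    push_cast
    rw [coboundaryAdj, Finset.sum_mul, Finset.sum_mul, ← Finset.sum_sub_distrib]
    refine Finset.sum_congr rfl fun v _ => ?_
    by_cases hv : G.IsFlagSimplex (Fin.cons v σ : Fin (m + 2) → V)
    · simp only [coboundary, if_pos hv, Fin.sum_univ_succ (n := m + 1)]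
      have h₀ : (Fin.cons v σ : Fin (m + 2) → V) ∘ (0 : Fin (m + 2)).succAbove = σ := by
        funext j; simp
      have hs (i : Fin (m + 1)) : (Fin.cons v σ : Fin (m + 2) → V) ∘ i.succ.succAbove =
          Fin.cons v (σ ∘ i.succAbove) := by
        funext j
        cases j using Fin.cases <;> simp
      simp only [h₀, hs, add_mul, Finset.sum_mul]
      rw [sub_eq_add_neg, ← Finset.sum_neg_distrib]
      congr 1
      · simp [sq]
      · refine Finset.sum_congr rfl fun i _ => ?_
        rw [hφ.apply_eq_cons_removeNth i σ]
        have : ((-1 : ℝ) ^ (i : ℕ)) * (-1) ^ (i : ℕ) = 1 := by rw [← mul_pow]; norm_num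
        rw [Fin.val_succ, pow_succ]
        linear_combination -φ (Fin.cons v (σ ∘ i.succAbove)) *
          φ (Fin.cons (σ i) (σ ∘ i.succAbove)) * this
    · simp [coboundary, hv]
  simp only [h₁, Finset.sum_sub_distrib]
  congr 1
  rw [Finset.sum_comm]
  simp only [sum_apply_removeNth _ (fun u τ => ∑ v : V,
    if G.IsFlagSimplex (Fin.cons v (Fin.cons u τ : Fin (m + 1) → V)) then
      φ (Fin.cons v τ) * φ (Fin.cons u τ) else 0)]
  simp only [Finset.sum_const, Finset.card_univ, Fintype.card_fin, nsmul_eq_mul]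
  push_cast
  congr 1
  rw [Finset.sum_comm]

open scoped Classical in
theorem cochainInner_flagLaplacian [DecidableEq V] {m : ℕ} {φ : (Fin (m + 1) → V) → ℝ}
    (hφ : G.IsFlagCochain φ) :
    cochainInner (G.flagLaplacian φ) φ = ((m + 1).factorial : ℝ)⁻¹ *
      (((m : ℝ) + 1) * ∑ τ : Fin m → V, (∑ v : V, φ (Fin.cons v τ)) ^ 2 +
        (∑ σ, (G.simplexDeg σ : ℝ) * φ σ ^ 2 -
          ((m : ℝ) + 1) * ∑ τ : Fin m → V, ∑ u : V, ∑ v : V,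
            if G.IsFlagSimplex (Fin.cons v (Fin.cons u τ : Fin (m + 1) → V)) then
              φ (Fin.cons v τ) * φ (Fin.cons u τ) else 0)) := by
  rw [cochainInner]
  simp only [flagLaplacian, add_mul (G.coboundary _ _), Finset.sum_add_distrib]
  rw [hφ.sum_coboundary_coboundaryAdj, hφ.sum_coboundaryAdj_coboundary]

theorem sum_removeNth_mul_sq {m : ℕ} {φ : (Fin (m + 1) → V) → ℝ} (hφ : G.IsFlagCochain φ)
    (f : (Fin m → V) → ℝ) :
    ∑ σ : Fin (m + 1) → V, (∑ i : Fin (m + 1), f (σ ∘ i.succAbove)) * φ σ ^ 2 =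
      ((m : ℝ) + 1) * ∑ u : V, ∑ τ : Fin m → V, f τ * φ (Fin.cons u τ) ^ 2 := by
  have h₁ (σ : Fin (m + 1) → V) : (∑ i : Fin (m + 1), f (σ ∘ i.succAbove)) * φ σ ^ 2 =
      ∑ i : Fin (m + 1), f (σ ∘ i.succAbove) *
        φ (Fin.cons (σ i) (σ ∘ i.succAbove)) ^ 2 := by
    rw [Finset.sum_mul]
    refine Finset.sum_congr rfl fun i _ => ?_
    rw [hφ.apply_eq_cons_removeNth i σ, mul_pow, ← pow_mul, mul_comm (i : ℕ), pow_mul]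
    norm_num
  simp only [h₁]
  rw [Finset.sum_comm]
  simp only [sum_apply_removeNth _ (fun u τ => f τ * φ (Fin.cons u τ) ^ 2)]
  simp

end IsFlagCochain

end SimpleGraph

/-- The key identity (3) of Aharoni–Berger–Meshulam: for a `(k+1)`-cochain `φ` of the flag
complex `X(G)` (a `k`-cochain with `k ≥ 1` in the paper's indexing),
`k·(Δ_k φ, φ) = ∑_{u∈V} (Δ_{k-1} φ_u, φ_u)
− ∑_{σ∈X(k)} (∑_{τ∈σ(k-1)} deg(τ) − k·deg(σ))·φ(σ)²`. -/
theorem laplacian_inner_identity {V : Type*} [Fintype V] [DecidableEq V] (G : SimpleGraph V)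
    (k : ℕ) (φ : (Fin (k + 2) → V) → ℝ) (hφ : G.IsFlagCochain φ) :
    ((k : ℝ) + 1) * cochainInner (G.flagLaplacian φ) φ =
      (∑ u : V, cochainInner (G.flagLaplacian (G.cochainRes φ u)) (G.cochainRes φ u)) -
        ((Nat.factorial (k + 2) : ℝ))⁻¹ *
          ∑ σ : Fin (k + 2) → V,
            ((∑ i : Fin (k + 2), (G.simplexDeg (σ ∘ i.succAbove) : ℝ)) -
                ((k : ℝ) + 1) * (G.simplexDeg σ : ℝ)) * φ σ ^ 2 := by
  classical
  have hsq : ∑ τ : Fin (k + 1) → V, (∑ v : V, φ (Fin.cons v τ)) ^ 2 =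
      ∑ u : V, ∑ ρ : Fin k → V, (∑ v : V, G.cochainRes φ u (Fin.cons v ρ)) ^ 2 := by
    rw [sum_cons_tuple]
    refine Finset.sum_congr rfl fun u _ => Finset.sum_congr rfl fun ρ _ => ?_
    simp only [hφ.cochainRes_apply, hφ.cons_cons u, Finset.sum_neg_distrib, neg_sq]
  have hcross : (∑ τ : Fin (k + 1) → V, ∑ u : V, ∑ v : V,
      if G.IsFlagSimplex (Fin.cons v (Fin.cons u τ : Fin (k + 2) → V)) then
        φ (Fin.cons v τ) * φ (Fin.cons u τ) else 0) =
      ∑ w : V, ∑ ρ : Fin k → V, ∑ u : V, ∑ v : V,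
        if G.IsFlagSimplex (Fin.cons v (Fin.cons u ρ : Fin (k + 1) → V)) then
          G.cochainRes φ w (Fin.cons v ρ) * G.cochainRes φ w (Fin.cons u ρ) else 0 := by
    rw [sum_cons_tuple]
    refine Finset.sum_congr rfl fun w _ => Finset.sum_congr rfl fun ρ _ =>
      Finset.sum_congr rfl fun u _ => Finset.sum_congr rfl fun v _ => ?_
    rw [hφ.cochainRes_apply, hφ.cochainRes_apply, hφ.cons_cons w, hφ.cons_cons w, neg_mul_neg]
    by_cases hv : φ (Fin.cons v (Fin.cons w ρ : Fin (k + 1) → V)) = 0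
    · simp [hv]
    by_cases hu : φ (Fin.cons u (Fin.cons w ρ : Fin (k + 1) → V)) = 0
    · simp [hu]
    have hv' := not_imp_comm.1 (hφ.1 _) hv
    have hu' := not_imp_comm.1 (hφ.1 _) hu
    refine if_congr ?_ rfl rfl
    simp only [SimpleGraph.isFlagSimplex_cons, Fin.forall_fin_succ, Fin.cons_zero,
      Fin.cons_succ] at hv' hu' ⊢
    tauto
  have hdeg := hφ.sum_removeNth_mul_sq fun τ => (G.simplexDeg τ : ℝ)
  simp only [fun u => (hφ.cochainRes u).cochainInner_flagLaplacian]
  rw [← Finset.mul_sum, Finset.sum_add_distrib, Finset.sum_sub_distrib, ← Finset.mul_sum,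
    ← Finset.mul_sum, ← hsq, ← hcross, hφ.cochainInner_flagLaplacian]
  simp only [sub_mul, Finset.sum_sub_distrib]
  rw [hdeg]
  simp only [hφ.cochainRes_apply, mul_assoc, ← Finset.mul_sum]
  rw [Nat.factorial_succ (k + 1)]
  push_cast
  have hfac : ((k + 1).factorial : ℝ) ≠ 0 := by positivity
  have hk : (k : ℝ) + 1 + 1 ≠ 0 := by positivity
  field_simp
  ring
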